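/- Let K be a field and m < n positive integers. Let f = (∏_{k=0}^{m-2} det(X_{[1,k+1]}^{[m-k,m]}) · det(X_{[n-k,n]}^{[1,k+1]})) · ∏_{k=1}^{n-m+1} det(X_{[k,m+k-1]}) in S = K[x_{ij} : 1 ≤ i ≤ m, 1 ≤ j ≤ n]. Then for every t with 1 ≤ t ≤ m, the determinantal ideal I_t(X) generated by all t×t minors of the generic matrix X belongs to the family of Knutson ideals C_f. -/

import Mathlib

/-- The ideal of `t × t` minors of the generic `m × n` matrix `X` (with entries
`X i j = MvPolynomial.X (i, j)`), using only rows with 1-based index in `[r1, r2]`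
and columns with 1-based index in `[c1, c2]`. -/
noncomputable def genMinors (K : Type*) [Field K] (m n : ℕ) (t : ℕ) (r1 r2 c1 c2 : ℕ) :
    Ideal (MvPolynomial (Fin m × Fin n) K) :=
  Ideal.span { p | ∃ (r : Fin t → Fin m) (c : Fin t → Fin n),
    StrictMono r ∧ StrictMono c ∧
    (∀ i, r1 ≤ (r i).val + 1 ∧ (r i).val + 1 ≤ r2) ∧
    (∀ j, c1 ≤ (c j).val + 1 ∧ (c j).val + 1 ≤ c2) ∧
    p = Matrix.det (Matrix.of fun i j => MvPolynomial.X (r i, c j)) }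

/-- The polynomial
`f = (∏_{k=0}^{m-2} det X_{[1,k+1]}^{[m-k,m]} ⬝ det X_{[n-k,n]}^{[1,k+1]}) ⬝ ∏_{k=1}^{n-m+1} det X_{[k,m+k-1]}`
(1-based intervals, subscripts = columns, superscripts = rows). -/
noncomputable def knutsonF (K : Type*) [Field K] (m n : ℕ) (hm : 0 < m) (hmn : m < n) :
    MvPolynomial (Fin m × Fin n) K :=
  (∏ k : Fin (m - 1),
      (Matrix.det (Matrix.of fun (i j : Fin (k.val + 1)) =>
        MvPolynomial.X ((⟨m - 1 - k.val + i.val, by omega⟩ : Fin m),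
                        (⟨j.val, by omega⟩ : Fin n)))
      * Matrix.det (Matrix.of fun (i j : Fin (k.val + 1)) =>
        MvPolynomial.X ((⟨i.val, by omega⟩ : Fin m),
                        (⟨n - 1 - k.val + j.val, by omega⟩ : Fin n)))))
  * ∏ k : Fin (n - m + 1),
      Matrix.det (Matrix.of fun (i j : Fin m) =>
        MvPolynomial.X ((⟨i.val, i.isLt⟩ : Fin m), (⟨k.val + j.val, by omega⟩ : Fin n)))

/-- The family of Knutson ideals `C_f`: the smallest set of ideals containing `(f)`,
closed under colon ideals by arbitrary ideals, and under sums and intersections. -/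
inductive IsKnutson {K : Type*} [Field K] {m n : ℕ}
    (f : MvPolynomial (Fin m × Fin n) K) : Ideal (MvPolynomial (Fin m × Fin n) K) → Prop
  | base : IsKnutson f (Ideal.span {f})
  | colon (I J : Ideal (MvPolynomial (Fin m × Fin n) K)) :
      IsKnutson f I → IsKnutson f (I.colon J)
  | add (I J : Ideal (MvPolynomial (Fin m × Fin n) K)) :
      IsKnutson f I → IsKnutson f J → IsKnutson f (I + J)
  | inf (I J : Ideal (MvPolynomial (Fin m × Fin n) K)) :
      IsKnutson f I → IsKnutson f J → IsKnutson f (I ⊓ J)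

open MvPolynomial in
/-- Minor of a generalized matrix with arbitrary row and column selections. -/
noncomputable def mdet {R ι κ : Type*} [CommRing R] {t : ℕ} (x : ι × κ → R)
    (r : Fin t → ι) (c : Fin t → κ) : R :=
  Matrix.det (Matrix.of fun i j => x (r i, c j))

section basic
variable {R R' ι κ : Type*} [CommRing R] [CommRing R']

lemma mdet_map {t : ℕ} (φ : R →+* R') (x : ι × κ → R) (r : Fin t → ι) (c : Fin t → κ) :
    φ (mdet x r c) = mdet (fun z => φ (x z)) r c := by
  unfold mdet
  rw [RingHom.map_det]
  rfl

lemma mdet_congr {t : ℕ} {x y : ι × κ → R} {r : Fin t → ι} {c : Fin t → κ}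
    (h : ∀ i j, x (r i, c j) = y (r i, c j)) : mdet x r c = mdet y r c := by
  unfold mdet
  congr 1
  ext i j
  exact h i j

lemma mdet_zero_size (x : ι × κ → R) (r : Fin 0 → ι) (c : Fin 0 → κ) : mdet x r c = 1 := by
  simp [mdet]

lemma cramer_exists {s : ℕ} (x : ι × κ → R) (r : Fin s → ι) (c : Fin s → κ) (v : κ) :
    ∃ z : Fin s → R, ∀ i : ι,
      mdet x (Fin.cons i r : Fin (s+1) → ι) (Fin.cons v c : Fin (s+1) → κ) =
        x (i, v) * mdet x r c + ∑ j, z j * x (i, c j) := by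
  refine ⟨fun j => (-1) ^ ((j : ℕ) + 1) *
    mdet x r (fun l => (Fin.cons v c : Fin (s+1) → κ) (j.succ.succAbove l)), fun i => ?_⟩
  unfold mdet
  rw [Matrix.det_succ_row_zero, Fin.sum_univ_succ]
  congr 1
  · simp [Matrix.submatrix]
  · refine Finset.sum_congr rfl fun j _ => ?_
    simp only [Matrix.of_apply, Fin.cons_zero, Fin.cons_succ, Fin.val_succ, Matrix.submatrix]
    ring

/-- The exchange lemma. -/
lemma exchange {s p : ℕ} (x : ι × κ → R) (r : Fin s → ι) (c : Fin s → κ) (v : κ)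
    (r' : Fin p → ι) (c' : Fin p → κ) (l : Fin p) (hl : c' l = v) (I : Ideal R)
    (h1 : ∀ i, mdet x (Fin.cons i r : Fin (s+1) → ι) (Fin.cons v c : Fin (s+1) → κ) ∈ I)
    (h2 : ∀ j, mdet x r' (Function.update c' l (c j)) ∈ I) :
    mdet x r c * mdet x r' c' ∈ I := by
  obtain ⟨z, hz⟩ := cramer_exists x r c v
  cases p with
  | zero => exact l.elim0
  | succ p =>
  have key : ∀ w, mdet x r' (Function.update c' l w) = ∑ i : Fin (p+1),
      x (r' i, w) * ((-1) ^ ((i : ℕ) + l) * mdet x (fun k => r' (i.succAbove k))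
        (fun k => c' (l.succAbove k))) := by
    intro w
    unfold mdet
    rw [Matrix.det_succ_column _ l]
    refine Finset.sum_congr rfl fun i _ => ?_
    have : ((Matrix.of fun i j => x (r' i, Function.update c' l w j)).submatrix
        i.succAbove l.succAbove) =
        Matrix.of fun k k' => x (r' (i.succAbove k), c' (l.succAbove k')) := by
      ext a b
      simp [Matrix.submatrix, Function.update_of_ne]
    rw [this]
    simp
    ring
  have k0 : mdet x r' c' = mdet x r' (Function.update c' l v) := by
    rw [← hl, Function.update_eq_self]
  have : mdet x r c * mdet x r' c' =
      (∑ i : Fin (p+1), mdet x (Fin.cons (r' i) r : Fin (s+1) → ι) (Fin.cons v c : Fin (s+1) → κ)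
        * ((-1) ^ ((i : ℕ) + l) * mdet x (fun k => r' (i.succAbove k))
        (fun k => c' (l.succAbove k)))) -
      ∑ j, z j * mdet x r' (Function.update c' l (c j)) := by
    rw [k0]
    simp only [key, hz, add_mul, Finset.sum_add_distrib, Finset.mul_sum, Finset.sum_mul]
    rw [Finset.sum_comm (γ := Fin s)]
    rw [eq_sub_iff_add_eq]
    congr 1
    · exact Finset.sum_congr rfl fun _ _ => by ring
    · exact Finset.sum_congr rfl fun _ _ => Finset.sum_congr rfl fun _ _ => by ring
  rw [this]
  refine I.sub_mem (I.sum_mem fun i _ => I.mul_mem_right _ (h1 _))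
    (I.sum_mem fun j _ => I.mul_mem_left _ (h2 j))

lemma mdet_eq_zero_of_factor {t : ℕ} {τ : Type*} [Fintype τ] (hc : Fintype.card τ < t)
    (x : ι × κ → R) (r : Fin t → ι) (c : Fin t → κ) (Y : Fin t → τ → R) (Z : τ → Fin t → R)
    (h : ∀ i j, x (r i, c j) = ∑ l, Y i l * Z l j) : mdet x r c = 0 := by
  classical
  let e0 := Fintype.equivFin τ
  let e : τ → Fin t := fun l => Fin.castLE hc.le (e0 l)
  have he : Function.Injective e := (Fin.castLE_injective _).comp e0.injective
  let Y' : Matrix (Fin t) (Fin t) R := Matrix.of fun i k => Function.extend e (Y i) 0 k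
  let Z' : Matrix (Fin t) (Fin t) R := Matrix.of fun k j => Function.extend e (fun l => Z l j) 0 k
  have hY : Y'.det = 0 := by
    refine Matrix.det_eq_zero_of_column_eq_zero ⟨Fintype.card τ, hc⟩ fun i => ?_
    refine Function.extend_apply' _ _ _ ?_
    rintro ⟨l, hl⟩
    have := congrArg Fin.val hl
    simp only [e, Fin.val_castLE] at this
    have := (e0 l).2
    omega
  have : (Matrix.of fun i j => x (r i, c j)) = Y' * Z' := by
    ext i j
    rw [Matrix.mul_apply, Matrix.of_apply, h]
    rw [← Finset.sum_subset (Finset.subset_univ (Finset.univ.image e))]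
    · rw [Finset.sum_image (fun _ _ _ _ h => he h)]
      simp [Y', Z', he.extend_apply]
    · intro k _ hk
      have : ¬ ∃ l, e l = k := by simpa using hk
      simp [Y', Function.extend_apply' _ _ _ this]
  unfold mdet
  rw [this, Matrix.det_mul, hY, zero_mul]

lemma mdet_eq_zero_of_row {t : ℕ} (x : ι × κ → R) (r : Fin t → ι) (c : Fin t → κ)
    (h : ¬ Function.Injective r) : mdet x r c = 0 := by
  simp only [Function.Injective, not_forall] at h
  obtain ⟨i, j, h, hn⟩ := h
  exact Matrix.det_zero_of_row_eq hn (by ext k; simp [h])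

lemma mdet_eq_zero_of_col {t : ℕ} (x : ι × κ → R) (r : Fin t → ι) (c : Fin t → κ)
    (h : ¬ Function.Injective c) : mdet x r c = 0 := by
  simp only [Function.Injective, not_forall] at h
  obtain ⟨i, j, h, hn⟩ := h
  exact Matrix.det_zero_of_column_eq hn (by intro k; simp [h])

lemma mdet_comp_mem {t : ℕ} (x : ι × κ → R) (r : Fin t → ι) (c : Fin t → κ)
    (σ τ : Fin t → Fin t) (I : Ideal R) (h : mdet x r c ∈ I) :
    mdet x (r ∘ σ) (c ∘ τ) ∈ I := by
  by_cases hσ : Function.Injective σ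
  · by_cases hτ : Function.Injective τ
    · let s := Equiv.ofBijective σ (Finite.injective_iff_bijective.mp hσ)
      let u := Equiv.ofBijective τ (Finite.injective_iff_bijective.mp hτ)
      have : mdet x (r ∘ σ) (c ∘ τ) = (Equiv.Perm.sign s : ℤ) *
          ((Equiv.Perm.sign u : ℤ) * mdet x r c) := by
        unfold mdet
        rw [← Matrix.det_permute' u, ← Matrix.det_permute s]
        rfl
      rw [this]
      exact I.mul_mem_left _ (I.mul_mem_left _ h)
    · rw [mdet_eq_zero_of_col _ _ _ (fun h => hτ h.of_comp)]
      exact I.zero_mem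
  · rw [mdet_eq_zero_of_row _ _ _ (fun h => hσ h.of_comp)]
    exact I.zero_mem

end basic

section field
variable {L ι κ : Type*} [Field L]

/-- The part of `x` with rows in `P`, columns in `Q` factors through `L^p`. -/
def RkLE (x : ι × κ → L) (P : ι → Prop) (Q : κ → Prop) (p : ℕ) : Prop :=
  ∃ (Y : ι → Fin p → L) (Z : Fin p → κ → L), ∀ i j, P i → Q j → x (i, j) = ∑ l, Y i l * Z l j

lemma RkLE.succ {x : ι × κ → L} {P : ι → Prop} {Q : κ → Prop} {p : ℕ} (h : RkLE x P Q p) :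
    RkLE x P Q (p+1) := by
  obtain ⟨Y, Z, h⟩ := h
  refine ⟨fun i => Fin.cons 0 (Y i), fun l j => (Fin.cons 0 (fun l => Z l j) : Fin (p+1) → L) l, ?_⟩
  intro i j hi hj
  rw [h i j hi hj, Fin.sum_univ_succ]
  simp

lemma RkLE.mdet_eq_zero {x : ι × κ → L} {P : ι → Prop} {Q : κ → Prop} {p t : ℕ}
    (h : RkLE x P Q p) (hp : p < t) (r : Fin t → ι) (c : Fin t → κ) (hr : ∀ i, P (r i))
    (hc : ∀ j, Q (c j)) : mdet x r c = 0 := by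
  obtain ⟨Y, Z, h⟩ := h
  exact mdet_eq_zero_of_factor (by simpa using hp) x r c (fun i => Y (r i)) (fun l j => Z l (c j))
    fun i j => h _ _ (hr i) (hc j)

lemma cramer_field {s : ℕ} {x : ι × κ → L} {P : ι → Prop} (r : Fin s → ι) (c : Fin s → κ)
    (v : κ) (h0 : mdet x r c ≠ 0)
    (h : ∀ i, P i →
      mdet x (Fin.cons i r : Fin (s+1) → ι) (Fin.cons v c : Fin (s+1) → κ) = 0) :
    ∃ z : Fin s → L, ∀ i, P i → x (i, v) = ∑ l, x (i, c l) * z l := by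
  obtain ⟨z, hz⟩ := cramer_exists x r c v
  refine ⟨fun l => - z l / mdet x r c, fun i hi => ?_⟩
  have h1 := hz i
  rw [h i hi] at h1
  have : ∑ l, x (i, c l) * (- z l / mdet x r c) = -(∑ l, z l * x (i, c l)) / mdet x r c := by
    rw [← Finset.sum_neg_distrib, Finset.sum_div]
    exact Finset.sum_congr rfl fun _ _ => by ring
  rw [this, eq_div_iff h0]
  linear_combination -h1

lemma RkLE.of_minor {x : ι × κ → L} {P : ι → Prop} {Q : κ → Prop} {p : ℕ}
    (r : Fin p → ι) (c : Fin p → κ) (hr : ∀ i, P (r i)) (hc : ∀ j, Q (c j)) (h0 : mdet x r c ≠ 0)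
    (h : ∀ (r : Fin (p+1) → ι) (c : Fin (p+1) → κ), (∀ i, P (r i)) → (∀ j, Q (c j)) →
      mdet x r c = 0) : RkLE x P Q p := by
  have : ∀ v, ∃ z : Fin p → L, Q v → ∀ i, P i → x (i, v) = ∑ l, x (i, c l) * z l := by
    intro v
    by_cases hv : Q v
    · obtain ⟨z, hz⟩ := cramer_field (P := P) r c v h0 (fun i hi => h _ _
        (fun k => by refine Fin.cases ?_ (fun k => ?_) k <;> simp [hi, hr])
        (fun k => by refine Fin.cases ?_ (fun k => ?_) k <;> simp [hv, hc]))
      exact ⟨z, fun _ => hz⟩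
    · exact ⟨0, fun h => absurd h hv⟩
  choose z hz using this
  exact ⟨fun i l => x (i, c l), fun l v => z v l, fun i j hi hj => hz j hj i hi⟩

lemma RkLE.of_minors {x : ι × κ → L} {P : ι → Prop} {Q : κ → Prop} (p : ℕ)
    (h : ∀ (r : Fin (p+1) → ι) (c : Fin (p+1) → κ), (∀ i, P (r i)) → (∀ j, Q (c j)) →
      mdet x r c = 0) : RkLE x P Q p := by
  induction p with
  | zero =>
    exact RkLE.of_minor Fin.elim0 Fin.elim0 (fun i => i.elim0) (fun i => i.elim0)
      (by simp [mdet_zero_size]) h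
  | succ p ih =>
    by_cases h' : ∀ (r : Fin (p+1) → ι) (c : Fin (p+1) → κ), (∀ i, P (r i)) → (∀ j, Q (c j)) →
      mdet x r c = 0
    · exact (ih h').succ
    · push Not at h'
      obtain ⟨r, c, hr, hc, h0⟩ := h'
      exact RkLE.of_minor r c hr hc h0 h

end field
section null
variable {L : Type*} [Field L]

/-- All `t`-minors of the upper left `a × b` box vanish. -/
def BoxZero (x : ℕ × ℕ → L) (d : ℕ × ℕ × ℕ) : Prop :=
  ∀ r c : Fin d.2.2 → ℕ, (∀ i, r i < d.1) → (∀ j, c j < d.2.1) → mdet x r c = 0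

/-- The points satisfying all conditions in `D`. -/
def PtD (D : Finset (ℕ × ℕ × ℕ)) (x : ℕ × ℕ → L) : Prop := ∀ d ∈ D, BoxZero x d

lemma not_boxZero_zero (x : ℕ × ℕ → L) (a b : ℕ) : ¬ BoxZero x (a, b, 0) := by
  intro h
  have := h Fin.elim0 Fin.elim0 (fun i => i.elim0) (fun i => i.elim0)
  rw [mdet_zero_size] at this
  exact one_ne_zero this

lemma boxZero_succ_iff (x : ℕ × ℕ → L) (a b p : ℕ) :
    BoxZero x (a, b, p+1) ↔ RkLE x (· < a) (· < b) p :=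
  ⟨fun h => RkLE.of_minors p h, fun h _ _ hr hc => h.mdet_eq_zero (Nat.lt_succ_self p) _ _ hr hc⟩

lemma BoxZero.congr {x y : ℕ × ℕ → L} {d : ℕ × ℕ × ℕ} (h : BoxZero x d)
    (hxy : ∀ i j, i < d.1 → j < d.2.1 → y (i, j) = x (i, j)) : BoxZero y d := by
  intro r c hr hc
  rw [mdet_congr (y := x) (fun i j => hxy _ _ (hr i) (hc j))]
  exact h r c hr hc

/-- The curve. -/
def xs {R : Type*} [CommRing R] (a b : ℕ) (x : ℕ × ℕ → R) (s : R) : ℕ × ℕ → R := fun z =>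
  if z.1 < a ∧ z.2 < b then x z + s * x (z.1, b) * x (a, z.2) else x z

lemma curve_mem {a b p : ℕ} {D0 : Finset (ℕ × ℕ × ℕ)}
    (hD : ∀ d ∈ D0, (a + 1 ≤ d.1 ∧ d.2.1 ≤ b) ∨ (d.1 ≤ a ∧ b + 1 ≤ d.2.1))
    {x : ℕ × ℕ → L} (hx : PtD (insert (a, b, p) D0) x) {s : L} (hs : s ≠ 0) :
    PtD (insert (a+1, b+1, p+1) D0) (Function.update (xs a b x s) (a, b) s⁻¹) := by
  intro d hd
  rw [Finset.mem_insert] at hd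
  rcases hd with rfl | hd
  · have h := hx (a, b, p) (Finset.mem_insert_self _ _)
    cases p with
    | zero => exact absurd h (not_boxZero_zero x a b)
    | succ q =>
      rw [boxZero_succ_iff] at h ⊢
      obtain ⟨Y, Z, h⟩ := h
      refine ⟨fun i => Fin.cons (if i = a then 1 else s * x (i, b)) (if i = a then 0 else Y i),
        fun l j => (Fin.cons (if j = b then s⁻¹ else x (a, j))
          (fun l => if j = b then 0 else Z l j) : Fin (q+1) → L) l, ?_⟩
      intro i j hi hj
      rw [Fin.sum_univ_succ]
      simp only [Fin.cons_zero, Fin.cons_succ]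
      by_cases hia : i = a
      · by_cases hjb : j = b
        · subst hia hjb; simp
        · subst hia; simp [hjb, xs]
      · by_cases hjb : j = b
        · subst hjb
          simp [hia, xs]
          field_simp
        · have h1 : i < a := by omega
          have h2 : j < b := by omega
          have := h i j h1 h2
          simp [hia, hjb, xs, h1, h2, this]
          ring
  · have h := hx d (Finset.mem_insert_of_mem hd)
    obtain ⟨a', b', t'⟩ := d
    cases t' with
    | zero => exact absurd h (not_boxZero_zero x _ _)
    | succ q =>
      rw [boxZero_succ_iff] at h ⊢
      obtain ⟨Y, Z, h⟩ := h
      rcases hD _ hd with ⟨h1, h2⟩ | ⟨h1, h2⟩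
      · simp only at h1 h2
        refine ⟨fun i l => Y i l + if i < a then s * x (i, b) * Y a l else 0, Z, ?_⟩
        intro i j hi hj
        have hne : (i, j) ≠ (a, b) := by
          intro h; simp at h; omega
        have hj' : j < b := by omega
        rw [Function.update_of_ne hne]
        simp only [add_mul, Finset.sum_add_distrib]
        rw [← h i j hi hj]
        by_cases hia : i < a
        · simp only [xs, hia, hj', and_self, if_true, mul_assoc, ← Finset.mul_sum]
          rw [← h a j (by omega) hj]
        · simp [xs, hia]
      · simp only at h1 h2
        refine ⟨Y, fun l j => Z l j + if j < b then s * x (a, j) * Z l b else 0, ?_⟩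
        intro i j hi hj
        have hne : (i, j) ≠ (a, b) := by
          intro h; simp at h; omega
        have hi' : i < a := by omega
        rw [Function.update_of_ne hne]
        simp only [mul_add, Finset.sum_add_distrib]
        rw [← h i j hi hj]
        by_cases hjb : j < b
        · have : ∑ l, Y i l * (s * x (a, j) * Z l b) = s * x (a, j) * ∑ l, Y i l * Z l b := by
            rw [Finset.mul_sum]
            exact Finset.sum_congr rfl fun _ _ => by ring
          simp only [xs, hjb, hi', and_self, if_true]
          rw [this, ← h i b hi (by omega)]
          ring
        · simp [xs, hjb]

lemma exists_completion {a b p : ℕ} {D0 : Finset (ℕ × ℕ × ℕ)}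
    (hD : ∀ d ∈ D0, (a + 1 ≤ d.1 ∧ d.2.1 ≤ b) ∨ (d.1 ≤ a ∧ b + 1 ≤ d.2.1))
    {x : ℕ × ℕ → L} (hx : PtD (insert (a, b+1, p+1) (insert (a+1, b, p+1) D0)) x)
    (h0 : ¬ BoxZero x (a, b, p)) :
    ∃ y : L, PtD (insert (a+1, b+1, p+1) D0) (Function.update x (a, b) y) := by
  have hx1 := hx (a, b+1, p+1) (by simp)
  have hx2 := hx (a+1, b, p+1) (by simp)
  unfold BoxZero at h0
  push Not at h0
  obtain ⟨r, c, hr, hc, h0⟩ := h0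
  simp only at r c hr hc h0
  have A : ∀ v, ∃ z : Fin p → L, v < b → ∀ i, i < a + 1 → x (i, v) = ∑ l, x (i, c l) * z l := by
    intro v
    by_cases hv : v < b
    · obtain ⟨z, hz⟩ := cramer_field (P := (· < a + 1)) r c v h0 (fun i hi => hx2 _ _
        (fun k => by refine Fin.cases ?_ (fun k => ?_) k <;> simp [hi, (hr _).trans (Nat.lt_succ_self _)])
        (fun k => by refine Fin.cases ?_ (fun k => ?_) k <;> simp [hv, hc]))
      exact ⟨z, fun _ => hz⟩
    · exact ⟨0, fun h => absurd h hv⟩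
  obtain ⟨w, hw⟩ := cramer_field (P := (· < a)) r c b h0 (fun i hi => hx1 _ _
        (fun k => by refine Fin.cases ?_ (fun k => ?_) k <;> simp [hi, hr])
        (fun k => by refine Fin.cases ?_ (fun k => ?_) k <;> simp [(hc _).trans (Nat.lt_succ_self _)]))
  choose z hz using A
  refine ⟨∑ l, x (a, c l) * w l, ?_⟩
  intro d hd
  rw [Finset.mem_insert] at hd
  rcases hd with rfl | hd
  · rw [boxZero_succ_iff]
    refine ⟨fun i l => x (i, c l), fun l j => if j = b then w l else z j l, ?_⟩
    intro i j hi hj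
    by_cases hjb : j = b
    · subst hjb
      by_cases hia : i = a
      · subst hia; simp
      · rw [Function.update_of_ne (by simp [hia])]
        simp [hw i (by omega)]
    · rw [Function.update_of_ne (by simp [hjb])]
      simp [hjb, hz j (by omega) i hi]
  · refine (hx d (by simp [hd])).congr fun i j hi hj => ?_
    apply Function.update_of_ne
    intro h
    simp at h
    have := hD d hd
    omega

end null

section null2
open MvPolynomial
variable (K : Type*) [Field K] (L : Type*) [Field L] [Algebra K L]

/-- The ideal of the conditions `D`. -/
noncomputable def idealD (D : Finset (ℕ × ℕ × ℕ)) : Ideal (MvPolynomial (ℕ × ℕ) K) :=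
  Ideal.span {p | ∃ d ∈ D, ∃ r c : Fin d.2.2 → ℕ, (∀ i, r i < d.1) ∧ (∀ j, c j < d.2.1) ∧
    p = mdet X r c}

/-- Nullstellensatz for `D`. -/
def NullD (D : Finset (ℕ × ℕ × ℕ)) : Prop :=
  ∀ F : MvPolynomial (ℕ × ℕ) K, (∀ x : ℕ × ℕ → L, PtD D x → aeval x F = 0) → F ∈ idealD K D

variable {K L}

lemma aeval_mdet {σ τ : Type*} {t : ℕ} (x : σ × τ → L) (r : Fin t → σ) (c : Fin t → τ) :
    aeval x (mdet (X : σ × τ → MvPolynomial (σ × τ) K) r c) = mdet x r c := by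
  have := mdet_map (aeval x : MvPolynomial (σ × τ) K →ₐ[K] L).toRingHom X r c
  simpa using this

lemma idealD_mono {D D' : Finset (ℕ × ℕ × ℕ)}
    (h : ∀ d ∈ D, ∃ d' ∈ D', d.1 ≤ d'.1 ∧ d.2.1 ≤ d'.2.1 ∧ d.2.2 = d'.2.2) :
    idealD K D ≤ idealD K D' := by
  refine Ideal.span_mono ?_
  rintro p ⟨⟨a, b, t⟩, hd, r, c, hr, hc, rfl⟩
  obtain ⟨⟨a', b', t'⟩, hd', h1, h2, h3⟩ := h _ hd
  simp only at h1 h2 h3 hr hc r c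
  subst h3
  exact ⟨_, hd', r, c, fun i => (hr i).trans_le h1, fun i => (hc i).trans_le h2, rfl⟩

lemma limit_lemma [Infinite L] {a b p : ℕ} {D0 : Finset (ℕ × ℕ × ℕ)}
    (hD : ∀ d ∈ D0, (a + 1 ≤ d.1 ∧ d.2.1 ≤ b) ∨ (d.1 ≤ a ∧ b + 1 ≤ d.2.1))
    (G : Polynomial (MvPolynomial (ℕ × ℕ) K)) (d : ℕ) (hG : G.natDegree ≤ d)
    (h : ∀ (x : ℕ × ℕ → L) (y : L), PtD (insert (a+1, b+1, p+1) D0) (Function.update x (a, b) y) →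
      G.eval₂ (aeval x : MvPolynomial (ℕ × ℕ) K →ₐ[K] L).toRingHom y = 0)
    (x : ℕ × ℕ → L) (hx : PtD (insert (a, b, p) D0) x) : aeval x (G.coeff d) = 0 := by
  let xT : ℕ × ℕ → Polynomial L := xs a b (fun z => Polynomial.C (x z)) Polynomial.X
  have hev : ∀ (s : L) (f : MvPolynomial (ℕ × ℕ) K),
      (aeval xT f : Polynomial L).eval s = aeval (xs a b x s) f := by
    intro s f
    have := comp_aeval_apply (R := K) (f := xT)
      ((Polynomial.aeval s : Polynomial L →ₐ[L] L).restrictScalars K) f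
    simp only [AlgHom.restrictScalars_apply, Polynomial.coe_aeval_eq_eval] at this
    rw [this]
    congr 2
    funext z
    simp only [xT, xs]
    split_ifs <;> simp [mul_comm s]
  let Q : Polynomial L := ∑ k ∈ Finset.range (d+1), aeval xT (G.coeff k) * Polynomial.X ^ (d - k)
  have hQ : ∀ s : L, s ≠ 0 → Q.eval s = 0 := by
    intro s hs
    have h1 := h _ _ (curve_mem hD hx hs)
    rw [Polynomial.eval₂_eq_sum_range' _ (Nat.lt_succ_of_le hG)] at h1
    simp only [Q, Polynomial.eval_finsetSum, Polynomial.eval_mul, hev, Polynomial.eval_pow,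
      Polynomial.eval_X]
    have : s ^ d * ∑ i ∈ Finset.range (d+1), (aeval (xs a b x s) : MvPolynomial (ℕ × ℕ) K →ₐ[K] L).toRingHom (G.coeff i) * s⁻¹ ^ i = 0 := by
      rw [h1, mul_zero]
    rw [← this, Finset.mul_sum]
    refine Finset.sum_congr rfl fun k hk => ?_
    have hk' : k ≤ d := by
      have := Finset.mem_range.mp hk
      omega
    have : s ^ d = s ^ (d - k) * s ^ k := by rw [← pow_add]; congr 1; omega
    rw [this]
    simp only [AlgHom.toRingHom_eq_coe, RingHom.coe_coe]
    rw [inv_pow]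
    field_simp
  have hQ0 : Q = 0 := by
    refine Polynomial.eq_zero_of_infinite_isRoot Q ?_
    refine (Set.Finite.infinite_compl (Set.finite_singleton (0 : L))).mono ?_
    intro s hs
    exact hQ s (by simpa using hs)
  have h2 : Q.eval 0 = 0 := by rw [hQ0]; simp
  simp only [Q, Polynomial.eval_finsetSum, Polynomial.eval_mul, hev, Polynomial.eval_pow,
      Polynomial.eval_X] at h2
  rw [Finset.sum_range_succ, Finset.sum_eq_zero] at h2
  · have hx0 : xs a b x 0 = x := by
      funext z
      simp [xs]
    simpa [hx0] using h2
  · intro k hk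
    have := Finset.mem_range.mp hk
    rw [zero_pow (by omega), mul_zero]

lemma corner_expand {R : Type*} [CommRing R] {a b p : ℕ} (x : ℕ × ℕ → R) (y : R)
    (r c : Fin p → ℕ) (hr : ∀ i, r i < a) (hc : ∀ j, c j < b) :
    mdet (Function.update x (a, b) y) (Fin.cons a r : Fin (p+1) → ℕ) (Fin.cons b c : Fin (p+1) → ℕ)
    = mdet x r c * y + mdet (Function.update x (a, b) 0) (Fin.cons a r : Fin (p+1) → ℕ)
      (Fin.cons b c : Fin (p+1) → ℕ) := by
  have key : ∀ y : R, mdet (Function.update x (a, b) y) (Fin.cons a r : Fin (p+1) → ℕ)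
      (Fin.cons b c : Fin (p+1) → ℕ) = mdet x r c * y + ∑ j : Fin p, (-1) ^ ((j : ℕ) + 1) *
        x (a, c j) * mdet x r (fun l => (Fin.cons b c : Fin (p+1) → ℕ) (j.succ.succAbove l)) := by
    intro y
    conv_lhs => unfold mdet
    rw [Matrix.det_succ_row_zero, Fin.sum_univ_succ]
    congr 1
    · have : (Matrix.of fun i j => (Function.update x (a, b) y)
        ((Fin.cons a r : Fin (p+1) → ℕ) i, (Fin.cons b c : Fin (p+1) → ℕ) j)).submatrix
          Fin.succ (Fin.succAbove 0) = Matrix.of fun i j => x (r i, c j) := by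
        ext i j
        simp only [Matrix.submatrix, Matrix.of_apply, Fin.cons_succ, Fin.zero_succAbove]
        apply Function.update_of_ne
        intro h
        have := hr i
        simp at h; omega
      rw [this]
      simp [mdet]
      ring
    · refine Finset.sum_congr rfl fun j _ => ?_
      have : (Matrix.of fun i j => (Function.update x (a, b) y)
        ((Fin.cons a r : Fin (p+1) → ℕ) i, (Fin.cons b c : Fin (p+1) → ℕ) j)).submatrix
          Fin.succ (Fin.succAbove j.succ) =
          Matrix.of fun i l => x (r i, (Fin.cons b c : Fin (p+1) → ℕ) (j.succ.succAbove l)) := by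
        ext i l
        simp only [Matrix.submatrix, Matrix.of_apply, Fin.cons_succ]
        apply Function.update_of_ne
        intro h
        have := hr i
        simp at h; omega
      rw [this]
      have hne : (a, c j) ≠ (a, b) := by
        intro h
        have := hc j
        simp at h; omega
      simp [mdet, Function.update_of_ne hne]
  rw [key y, key 0]
  simp

end null2
section null3
open MvPolynomial
variable {K : Type*} [Field K] {L : Type*} [Field L] [Algebra K L]

lemma lift_lin {a b p : ℕ} {D0 : Finset (ℕ × ℕ × ℕ)}
    (hD : ∀ d ∈ D0, (a + 1 ≤ d.1 ∧ d.2.1 ≤ b) ∨ (d.1 ≤ a ∧ b + 1 ≤ d.2.1))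
    (f : MvPolynomial (ℕ × ℕ) K) (hf : f ∈ idealD K (insert (a, b, p) D0)) :
    ∃ e : MvPolynomial (ℕ × ℕ) K, f * X (a, b) + e ∈ idealD K (insert (a+1, b+1, p+1) D0) ∧
      ∀ (x : ℕ × ℕ → L) (y : L),
        PtD (insert (a+1, b+1, p+1) D0) (Function.update x (a, b) y) →
        aeval x f * y + aeval x e = 0 := by
  unfold idealD at hf
  induction hf using Submodule.span_induction with
  | mem f hf =>
    obtain ⟨d, hd, r, c, hr, hc, rfl⟩ := hf
    rw [Finset.mem_insert] at hd
    rcases hd with rfl | hd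
    · simp only at r c hr hc
      have hr' : ∀ i, (Fin.cons a r : Fin (p+1) → ℕ) i < a + 1 := by
        intro k
        refine Fin.cases ?_ (fun k => ?_) k
        · simp
        · simpa using (hr k).trans (Nat.lt_succ_self _)
      have hc' : ∀ i, (Fin.cons b c : Fin (p+1) → ℕ) i < b + 1 := by
        intro k
        refine Fin.cases ?_ (fun k => ?_) k
        · simp
        · simpa using (hc k).trans (Nat.lt_succ_self _)
      refine ⟨mdet (Function.update X (a, b) 0) (Fin.cons a r : Fin (p+1) → ℕ)
        (Fin.cons b c : Fin (p+1) → ℕ), ?_, ?_⟩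
      · rw [← corner_expand X (X (a, b)) r c hr hc, Function.update_eq_self]
        exact Ideal.subset_span ⟨_, Finset.mem_insert_self _ _, _, _, hr', hc', rfl⟩
      · intro x y hx
        have h1 := hx _ (Finset.mem_insert_self _ _) _ _ hr' hc'
        rw [corner_expand x y r c hr hc] at h1
        rw [aeval_mdet]
        have := mdet_map (aeval x : MvPolynomial (ℕ × ℕ) K →ₐ[K] L).toRingHom
          (Function.update X (a, b) 0) (Fin.cons a r : Fin (p+1) → ℕ)
          (Fin.cons b c : Fin (p+1) → ℕ)
        simp only [AlgHom.toRingHom_eq_coe, RingHom.coe_coe] at this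
        rw [this, ← h1]
        congr 2
        funext z
        by_cases hz : z = (a, b)
        · subst hz; simp
        · simp [Function.update_of_ne hz]
    · refine ⟨0, ?_, ?_⟩
      · rw [add_zero]
        exact Ideal.mul_mem_right _ _ (Ideal.subset_span
          ⟨_, Finset.mem_insert_of_mem hd, _, _, hr, hc, rfl⟩)
      · intro x y hx
        have h1 := hx _ (Finset.mem_insert_of_mem hd) r c hr hc
        rw [aeval_mdet, mdet_congr (y := Function.update x (a, b) y), h1]
        · simp
        · intro i j
          rw [Function.update_of_ne]
          intro h
          simp at h
          have h2 := hD d hd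
          have h3 := hr i
          have h4 := hc j
          omega
  | zero => exact ⟨0, by simp, by simp⟩
  | add f g _ _ hf hg =>
    obtain ⟨e, he, he'⟩ := hf
    obtain ⟨e2, he2, he2'⟩ := hg
    refine ⟨e + e2, ?_, ?_⟩
    · convert Ideal.add_mem _ he he2 using 1
      ring
    · intro x y hx
      have h1 := he' x y hx
      have h2 := he2' x y hx
      simp only [map_add]
      linear_combination h1 + h2
  | smul c f _ hf =>
    obtain ⟨e, he, he'⟩ := hf
    refine ⟨c * e, ?_, ?_⟩
    · convert Ideal.mul_mem_left _ c he using 1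
      simp only [smul_eq_mul]
      ring
    · intro x y hx
      have h1 := he' x y hx
      simp only [map_mul, smul_eq_mul]
      linear_combination aeval x c * h1

lemma step_poly [Infinite L] {a b p : ℕ} {D0 : Finset (ℕ × ℕ × ℕ)}
    (hD : ∀ d ∈ D0, (a + 1 ≤ d.1 ∧ d.2.1 ≤ b) ∨ (d.1 ≤ a ∧ b + 1 ≤ d.2.1))
    (hC : NullD K L (insert (a, b, p) D0))
    (hN : NullD K L (insert (a, b+1, p+1) (insert (a+1, b, p+1) D0)))
    (d : ℕ) (G : Polynomial (MvPolynomial (ℕ × ℕ) K)) (hG : G.natDegree ≤ d)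
    (h : ∀ (x : ℕ × ℕ → L) (y : L), PtD (insert (a+1, b+1, p+1) D0) (Function.update x (a, b) y) →
      G.eval₂ (aeval x : MvPolynomial (ℕ × ℕ) K →ₐ[K] L).toRingHom y = 0) :
    G.eval (X (a, b)) ∈ idealD K (insert (a+1, b+1, p+1) D0) := by
  induction d generalizing G with
  | zero =>
    have hG0 := Polynomial.eq_C_of_natDegree_le_zero hG
    have hlim := limit_lemma hD G 0 hG h
    rw [hG0, Polynomial.eval_C]
    have : G.coeff 0 ∈ idealD K (insert (a, b+1, p+1) (insert (a+1, b, p+1) D0)) := by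
      refine hN _ fun x hx => ?_
      by_cases hb : BoxZero x (a, b, p)
      · refine hlim x ?_
        intro d hd
        rw [Finset.mem_insert] at hd
        rcases hd with rfl | hd
        · exact hb
        · exact hx d (by simp [hd])
      · obtain ⟨y, hy⟩ := exists_completion hD hx hb
        have := h x y hy
        rw [hG0, Polynomial.eval₂_C] at this
        exact this
    refine idealD_mono ?_ this
    intro d hd
    simp only [Finset.mem_insert] at hd
    rcases hd with rfl | rfl | hd
    · exact ⟨_, Finset.mem_insert_self _ _, by simp⟩
    · exact ⟨_, Finset.mem_insert_self _ _, by simp⟩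
    · exact ⟨d, Finset.mem_insert_of_mem hd, by simp⟩
  | succ d ih =>
    have hlim := limit_lemma hD G (d+1) hG h
    obtain ⟨e, he, he'⟩ := lift_lin (L := L) hD _ (hC _ hlim)
    set f := G.coeff (d+1) with hf
    have hG' := ih (G - (Polynomial.C f * Polynomial.X ^ (d+1) + Polynomial.C e * Polynomial.X ^ d))
      (by
        rw [Polynomial.natDegree_le_iff_coeff_eq_zero]
        intro N hN
        simp only [Polynomial.coeff_sub, Polynomial.coeff_add, Polynomial.coeff_C_mul,
          Polynomial.coeff_X_pow]
        rw [if_neg (by omega : ¬ N = d)]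
        by_cases h' : N = d + 1
        · subst h'; simp [hf]
        · rw [if_neg h', Polynomial.coeff_eq_zero_of_natDegree_lt (by omega)]; simp)
      (by
        intro x y hx
        have h1 := he' x y hx
        rw [Polynomial.eval₂_sub, h x y hx]
        simp only [Polynomial.eval₂_add, Polynomial.eval₂_mul, Polynomial.eval₂_C,
          Polynomial.eval₂_X_pow, AlgHom.toRingHom_eq_coe, RingHom.coe_coe]
        linear_combination (- y ^ d) * h1)
    have : G.eval (X (a, b)) = (G - (Polynomial.C f * Polynomial.X ^ (d+1) +
        Polynomial.C e * Polynomial.X ^ d)).eval (X (a, b)) +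
        X (a, b) ^ d * (f * X (a, b) + e) := by
      simp
      ring
    rw [this]
    exact Ideal.add_mem _ hG' (Ideal.mul_mem_left _ _ he)

lemma step_null [Infinite L] {a b p : ℕ} {D0 : Finset (ℕ × ℕ × ℕ)}
    (hD : ∀ d ∈ D0, (a + 1 ≤ d.1 ∧ d.2.1 ≤ b) ∨ (d.1 ≤ a ∧ b + 1 ≤ d.2.1))
    (hC : NullD K L (insert (a, b, p) D0))
    (hN : NullD K L (insert (a, b+1, p+1) (insert (a+1, b, p+1) D0))) :
    NullD K L (insert (a+1, b+1, p+1) D0) := by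
  intro F hF
  let Φ : MvPolynomial (ℕ × ℕ) K →ₐ[K] Polynomial (MvPolynomial (ℕ × ℕ) K) :=
    aeval (Function.update (fun z => Polynomial.C (X z)) (a, b) Polynomial.X)
  have h1 : (Φ F).eval (X (a, b)) = F := by
    have : ((Polynomial.aeval (X (a, b)) : Polynomial (MvPolynomial (ℕ × ℕ) K) →ₐ[_] _).restrictScalars
      K).comp Φ = AlgHom.id K _ := by
      ext z : 1
      by_cases hz : z = (a, b)
      · subst hz; simp [Φ]
      · simp [Φ, Function.update_of_ne hz]
    have := congrArg (fun g => g F) this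
    simpa using this
  have h2 : ∀ (x : ℕ × ℕ → L) (y : L),
      (Φ F).eval₂ (aeval x : MvPolynomial (ℕ × ℕ) K →ₐ[K] L).toRingHom y =
      aeval (Function.update x (a, b) y) F := by
    intro x y
    have : ((Polynomial.eval₂RingHom (aeval x : MvPolynomial (ℕ × ℕ) K →ₐ[K] L).toRingHom y).comp
      Φ.toRingHom) = (aeval (Function.update x (a, b) y) : MvPolynomial (ℕ × ℕ) K →ₐ[K] L).toRingHom := by
      apply MvPolynomial.ringHom_ext
      · intro k
        simp [Φ, Polynomial.algebraMap_eq, IsScalarTower.algebraMap_apply K (MvPolynomial (ℕ × ℕ) K) (Polynomial _)]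
      · intro z
        by_cases hz : z = (a, b)
        · subst hz; simp [Φ]
        · simp [Φ, Function.update_of_ne hz]
    have := congrArg (fun g => g F) this
    simpa using this
  rw [← h1]
  refine step_poly hD hC hN _ (Φ F) le_rfl fun x y hx => ?_
  rw [h2]
  exact hF _ hx

/-- Chain condition. -/
def Stair (D : Finset (ℕ × ℕ × ℕ)) : Prop :=
  ∀ d ∈ D, ∀ d' ∈ D, (d.1 ≤ d'.1 ∧ d'.2.1 ≤ d.2.1) ∨ (d'.1 ≤ d.1 ∧ d.2.1 ≤ d'.2.1)

/-- Termination measure. -/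
def meas (D : Finset (ℕ × ℕ × ℕ)) : ℕ := ∑ d ∈ D, 3 ^ (d.1 + d.2.1)

lemma meas_insert_le (d : ℕ × ℕ × ℕ) (D : Finset (ℕ × ℕ × ℕ)) :
    meas (insert d D) ≤ 3 ^ (d.1 + d.2.1) + meas D := by
  by_cases h : d ∈ D
  · rw [Finset.insert_eq_of_mem h]; exact Nat.le_add_left _ _
  · unfold meas
    rw [Finset.sum_insert h]

lemma meas_erase {d : ℕ × ℕ × ℕ} {D : Finset (ℕ × ℕ × ℕ)} (h : d ∈ D) :
    meas D = 3 ^ (d.1 + d.2.1) + meas (D.erase d) := by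
  unfold meas
  exact (Finset.add_sum_erase D (fun d => 3 ^ (d.1 + d.2.1)) h).symm

lemma null_of_erase {D : Finset (ℕ × ℕ × ℕ)} (d : ℕ × ℕ × ℕ)
    (h : NullD K L (D.erase d)) (h' : ∀ x : ℕ × ℕ → L, PtD (D.erase d) x → BoxZero x d) :
    NullD K L D := by
  intro F hF
  have := h F fun x hx => hF x fun e he => by
    by_cases hed : e = d
    · subst hed; exact h' x hx
    · exact hx e (Finset.mem_erase.mpr ⟨hed, he⟩)
  refine idealD_mono ?_ this
  intro e he
  exact ⟨e, Finset.mem_of_mem_erase he, by simp⟩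

theorem null_of_stair [Infinite L] (N : ℕ) : ∀ D : Finset (ℕ × ℕ × ℕ), meas D ≤ N → Stair D →
    NullD K L D := by
  induction N using Nat.strong_induction_on with
  | _ N ih =>
  intro D hDN hS
  have er : ∀ d ∈ D, NullD K L (D.erase d) := by
    intro d hd
    have h1 := meas_erase hd
    have h2 : 0 < 3 ^ (d.1 + d.2.1) := by positivity
    exact ih (meas (D.erase d)) (by omega) _ le_rfl fun e he e' he' =>
      hS e (Finset.mem_of_mem_erase he) e' (Finset.mem_of_mem_erase he')
  rcases D.eq_empty_or_nonempty with rfl | hne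
  · intro F hF
    have : F = 0 := by
      apply MvPolynomial.map_injective (algebraMap K L) (algebraMap K L).injective
      apply MvPolynomial.funext
      intro x
      have := hF x (by simp [PtD])
      rw [eval_map, ← aeval_def, this]
      simp
    rw [this]
    exact Ideal.zero_mem _
  obtain ⟨⟨a, b, t⟩, hd, hmax⟩ := D.exists_max_image (fun d => d.1 + d.2.1) hne
  simp only at hmax
  rcases t with _ | p
  · intro F hF
    have : (1 : MvPolynomial (ℕ × ℕ) K) ∈ idealD K D :=
      Ideal.subset_span ⟨_, hd, Fin.elim0, Fin.elim0, fun i => i.elim0, fun i => i.elim0,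
        (mdet_zero_size _ _ _).symm⟩
    rw [(Ideal.eq_top_iff_one _).mpr this]
    trivial
  rcases a with _ | a
  · exact null_of_erase _ (er _ hd) fun x _ r c hr _ => absurd (hr 0) (by simp)
  rcases b with _ | b
  · exact null_of_erase _ (er _ hd) fun x _ r c _ hc => absurd (hc 0) (by simp)
  by_cases hdup : ∃ t', (a+1, b+1, t') ∈ D ∧ t' ≠ p + 1
  · obtain ⟨t', ht', hne'⟩ := hdup
    have gen : ∀ u v, (a+1, b+1, u) ∈ D → (a+1, b+1, v) ∈ D → u < v → NullD K L D := by
      intro u v hu hv huv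
      refine null_of_erase (a+1, b+1, v) (er _ hv) fun x hx => ?_
      have hxu := hx (a+1, b+1, u) (Finset.mem_erase.mpr ⟨by simp; omega, hu⟩)
      rcases u with _ | u
      · exact absurd hxu (not_boxZero_zero _ _ _)
      · rw [boxZero_succ_iff] at hxu
        intro r c hr hc
        exact hxu.mdet_eq_zero (by simp; omega) r c hr hc
    rcases lt_or_gt_of_ne hne' with hlt | hlt
    · exact gen _ _ ht' hd hlt
    · exact gen _ _ hd ht' hlt
  push Not at hdup
  set D0 := D.erase (a+1, b+1, p+1) with hD0
  have hins : D = insert (a+1, b+1, p+1) D0 := (Finset.insert_erase hd).symm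
  have hmeas := meas_erase hd
  rw [← hD0] at hmeas
  simp only at hmeas
  have hDs : ∀ d ∈ D0, (a + 1 ≤ d.1 ∧ d.2.1 ≤ b) ∨ (d.1 ≤ a ∧ b + 1 ≤ d.2.1) := by
    rintro ⟨a', b', t'⟩ he
    have he1 := Finset.mem_of_mem_erase he
    have he2 := Finset.ne_of_mem_erase he
    have h1 := hS _ he1 _ hd
    have h2 := hmax _ he1
    have h3 : ¬ (a' = a + 1 ∧ b' = b + 1) := by
      rintro ⟨rfl, rfl⟩
      have := hdup _ he1
      subst this
      exact he2 rfl
    simp only at h1 h2 ⊢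
    omega
  have hS0 : ∀ d ∈ D0, ∀ d' ∈ D0, (d.1 ≤ d'.1 ∧ d'.2.1 ≤ d.2.1) ∨ (d'.1 ≤ d.1 ∧ d.2.1 ≤ d'.2.1) :=
    fun e he e' he' => hS e (Finset.mem_of_mem_erase he) e' (Finset.mem_of_mem_erase he')
  have e1 : 3 ^ (a + 1 + (b + 1)) = 9 * 3 ^ (a + b) := by ring
  have e2 : 3 ^ (a + (b + 1)) = 3 * 3 ^ (a + b) := by ring
  have e3 : 3 ^ (a + 1 + b) = 3 * 3 ^ (a + b) := by ring
  have e4 : 0 < 3 ^ (a + b) := by positivity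
  rw [hins]
  refine step_null hDs (ih (meas (insert (a, b, p) D0)) ?_ _ le_rfl ?_)
    (ih (meas (insert (a, b+1, p+1) (insert (a+1, b, p+1) D0))) ?_ _ le_rfl ?_)
  · have := meas_insert_le (a, b, p) D0
    simp only at this
    omega
  · intro e he e' he'
    rw [Finset.mem_insert] at he he'
    rcases he with rfl | he <;> rcases he' with rfl | he'
    · simp
    · have := hDs _ he'; simp only; omega
    · have := hDs _ he; simp only; omega
    · exact hS0 _ he _ he'
  · have := meas_insert_le (a, b+1, p+1) (insert (a+1, b, p+1) D0)
    have := meas_insert_le (a+1, b, p+1) D0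
    simp only at *
    omega
  · intro e he e' he'
    simp only [Finset.mem_insert] at he he'
    rcases he with rfl | rfl | he <;> rcases he' with rfl | rfl | he'
    all_goals first
      | exact hS0 _ he _ he'
      | (have := hDs _ he'; simp only; omega)
      | (have := hDs _ he; simp only; omega)
      | (simp only; omega)

end null3
section main
open MvPolynomial
variable {K : Type*} [Field K] {m n : ℕ}

/-- The ideal of `t`-minors using columns in `[lo, hi)`. -/
noncomputable def Acol (K : Type*) [Field K] (m n t lo hi : ℕ) :
    Ideal (MvPolynomial (Fin m × Fin n) K) :=
  Ideal.span {p | ∃ (r : Fin t → Fin m) (c : Fin t → Fin n),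
    (∀ j, lo ≤ (c j).val ∧ (c j).val < hi) ∧ p = mdet X r c}

lemma mem_Acol {t lo hi : ℕ} (r : Fin t → Fin m) (c : Fin t → Fin n)
    (h : ∀ j, lo ≤ (c j).val ∧ (c j).val < hi) : mdet X r c ∈ Acol K m n t lo hi :=
  Ideal.subset_span ⟨r, c, h, rfl⟩

lemma null_A {L : Type*} [Field L] [Algebra K L] [Infinite L] {t lo hi : ℕ} (hlh : lo ≤ hi)
    (hhi : hi ≤ n) (F : MvPolynomial (Fin m × Fin n) K)
    (h : ∀ M : Fin m × Fin n → L, (∀ (r : Fin t → Fin m) (c : Fin t → Fin n),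
      (∀ j, lo ≤ (c j).val ∧ (c j).val < hi) → mdet M r c = 0) → aeval M F = 0) :
    F ∈ Acol K m n t lo hi := by
  let e : Fin n → ℕ := fun j => if lo ≤ j.val then j.val - lo else j.val + (n - lo)
  have he : Function.Injective e := by
    intro i j hij
    simp only [e] at hij
    ext
    split_ifs at hij <;> omega
  let E : Fin m × Fin n → ℕ × ℕ := fun z => (z.1.val, e z.2)
  have hE : Function.Injective E := by
    rintro ⟨i, j⟩ ⟨i', j'⟩ h
    simp only [E, Prod.mk.injEq] at h
    exact Prod.ext (Fin.ext h.1) (he h.2)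
  have hmem : rename E F ∈ idealD K {(m, hi - lo, t)} := by
    refine null_of_stair (L := L) _ _ le_rfl ?_ _ ?_
    · intro d hd d' hd'
      simp only [Finset.mem_singleton] at hd hd'
      subst hd hd'
      simp
    · intro x hx
      rw [aeval_rename]
      apply h
      intro r c hc
      have := hx _ (Finset.mem_singleton_self _) (fun i => (r i).val) (fun j => e (c j))
        (fun i => (r i).2) (fun j => by
          have := hc j
          simp only [e]
          rw [if_pos this.1]
          omega)
      exact this
  let ρ : MvPolynomial (ℕ × ℕ) K →ₐ[K] MvPolynomial (Fin m × Fin n) K :=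
    aeval (Function.extend E X 0)
  have hρ : ρ (rename E F) = F := by
    simp only [ρ]
    rw [aeval_rename]
    have : (Function.extend E (X : _ → MvPolynomial (Fin m × Fin n) K) 0) ∘ E = X := by
      funext z
      exact hE.extend_apply _ _ _
    rw [this]
    simp
  rw [← hρ]
  have hle : idealD K {(m, hi - lo, t)} ≤ (Acol K m n t lo hi).comap ρ.toRingHom := by
    refine Ideal.span_le.mpr ?_
    rintro p ⟨d, hd, r, c, hr, hc, rfl⟩
    rw [Finset.mem_singleton] at hd
    subst hd
    simp only at r c hr hc
    show ρ.toRingHom (mdet X r c) ∈ Acol K m n t lo hi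
    rw [mdet_map]
    have : mdet (fun z => ρ.toRingHom (X z)) r c =
        mdet X (fun i => (⟨r i, hr i⟩ : Fin m))
          (fun j => (⟨lo + c j, by have := hc j; omega⟩ : Fin n)) := by
      unfold mdet
      congr 1
      ext i j : 2
      simp only [Matrix.of_apply, ρ, AlgHom.toRingHom_eq_coe, RingHom.coe_coe, aeval_X]
      rw [← hE.extend_apply X 0]
      congr 1
      simp [E, e]
    rw [this]
    apply mem_Acol
    intro j
    have := hc j
    simp only
    omega
  exact hle hmem

lemma Acol_isPrime (p lo hi : ℕ) (hlh : lo ≤ hi) (hhi : hi ≤ n) :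
    (Acol K m n (p+1) lo hi).IsPrime := by
  let φ : MvPolynomial (Fin m × Fin n) K →ₐ[K]
      MvPolynomial ((Fin m × Fin p) ⊕ (Fin p × Fin n) ⊕ (Fin m × Fin n)) K :=
    aeval fun z => if lo ≤ z.2.val ∧ z.2.val < hi then
      ∑ l : Fin p, X (Sum.inl (z.1, l)) * X (Sum.inr (Sum.inl (l, z.2))) else X (Sum.inr (Sum.inr z))
  have : Acol K m n (p+1) lo hi = RingHom.ker φ.toRingHom := by
    apply le_antisymm
    · refine Ideal.span_le.mpr ?_
      rintro _ ⟨r, c, hc, rfl⟩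
      show φ.toRingHom _ = 0
      rw [mdet_map]
      refine mdet_eq_zero_of_factor (τ := Fin p) (by simp) _ _ _
        (fun i l => X (Sum.inl (r i, l))) (fun l j => X (Sum.inr (Sum.inl (l, c j)))) ?_
      intro i j
      simp [φ, hc j]
    · intro F hF
      have hF : φ F = 0 := hF
      refine null_A (L := AlgebraicClosure K) hlh hhi F fun M hM => ?_
      obtain ⟨Y, Z, h⟩ := RkLE.of_minors (x := M) (P := fun _ => True)
        (Q := fun j => lo ≤ j.val ∧ j.val < hi) p (fun r c _ hc => hM r c hc)
      let ψ : MvPolynomial ((Fin m × Fin p) ⊕ (Fin p × Fin n) ⊕ (Fin m × Fin n)) K →ₐ[K]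
        AlgebraicClosure K := aeval (Sum.elim (fun z => Y z.1 z.2) (Sum.elim (fun z => Z z.1 z.2) M))
      have : aeval M = ψ.comp φ := by
        ext ⟨i, j⟩
        by_cases hj : lo ≤ j.val ∧ j.val < hi
        · simp [φ, ψ, hj, h i j trivial hj]
        · simp [φ, ψ, hj]
      rw [this]
      simp [hF]
  rw [this]
  exact RingHom.ker_isPrime _

lemma wit_eval {R : Type*} [CommRing R] {s : ℕ} (r : Fin s → Fin m) (c : Fin s → Fin n)
    (hr : Function.Injective r) (hc : Function.Injective c) :
    mdet (fun z : Fin m × Fin n => ∑ l, (if z.1 = r l then 1 else 0) * (if z.2 = c l then (1 : R) else 0)) r c = 1 := by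
  unfold mdet
  rw [← Matrix.det_one (n := Fin s)]
  congr 1
  ext i j
  simp [hr.eq_iff, hc.eq_iff, Matrix.one_apply]

lemma mdet_X_ne_zero {s : ℕ} (r : Fin s → Fin m) (c : Fin s → Fin n)
    (hr : Function.Injective r) (hc : Function.Injective c) :
    mdet (X : _ → MvPolynomial (Fin m × Fin n) K) r c ≠ 0 := by
  intro h
  have h1 := wit_eval (R := K) r c hr hc
  rw [← aeval_mdet (K := K), h] at h1
  simp at h1

lemma nzd {s p lo hi : ℕ} (hlh : lo ≤ hi) (hhi : hi ≤ n) (r : Fin s → Fin m) (c : Fin s → Fin n)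
    (hr : Function.Injective r) (hc : Function.Injective c)
    (hcard : Fintype.card {l // lo ≤ (c l).val ∧ (c l).val < hi} ≤ p)
    (F : MvPolynomial (Fin m × Fin n) K) (h : F * mdet X r c ∈ Acol K m n (p+1) lo hi) :
    F ∈ Acol K m n (p+1) lo hi := by
  have hp := Acol_isPrime (K := K) (m := m) p lo hi hlh hhi
  refine (hp.mem_or_mem h).resolve_right fun hH => ?_
  let M := (fun z : Fin m × Fin n =>
    ∑ l, (if z.1 = r l then 1 else 0) * (if z.2 = c l then (1 : K) else 0))
  have hle : Acol K m n (p+1) lo hi ≤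
      RingHom.ker (aeval M : MvPolynomial (Fin m × Fin n) K →ₐ[K] K).toRingHom := by
    refine Ideal.span_le.mpr ?_
    rintro _ ⟨r', c', hc', rfl⟩
    show aeval M _ = 0
    rw [aeval_mdet]
    refine mdet_eq_zero_of_factor (Nat.lt_succ_of_le hcard) _ _ _
      (fun i l => if r' i = r l.1 then 1 else 0) (fun l j => if c' j = c l.1 then 1 else 0) ?_
    intro i j
    simp only [M]
    rw [← Finset.sum_subtype (Finset.univ.filter fun l => lo ≤ (c l).val ∧ (c l).val < hi)
      (by simp) (fun l => (if r' i = r l then 1 else 0) * (if c' j = c l then (1 : K) else 0))]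
    rw [Finset.sum_filter_of_ne]
    intro l _ hl
    by_cases h : c' j = c l
    · rw [← h]; exact hc' j
    · simp [h] at hl
  have h0 : aeval M (mdet X r c) = 0 := hle hH
  rw [aeval_mdet, wit_eval r c hr hc] at h0
  exact one_ne_zero h0

variable {f : MvPolynomial (Fin m × Fin n) K}

lemma knutson_colon {t lo hi : ℕ} {I : Ideal (MvPolynomial (Fin m × Fin n) K)}
    (H : MvPolynomial (Fin m × Fin n) K) (hI : IsKnutson f I) (hle : I ≤ Acol K m n t lo hi)
    (h1 : ∀ (r : Fin t → Fin m) (c : Fin t → Fin n),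
      (∀ j, lo ≤ (c j).val ∧ (c j).val < hi) → mdet X r c * H ∈ I)
    (h2 : ∀ F, F * H ∈ Acol K m n t lo hi → F ∈ Acol K m n t lo hi) :
    IsKnutson f (Acol K m n t lo hi) := by
  have : Acol K m n t lo hi = I.colon (Ideal.span {H}) := by
    apply le_antisymm
    · refine Ideal.span_le.mpr ?_
      rintro _ ⟨r, c, hc, rfl⟩
      exact Ideal.mem_colon_span_singleton.mpr (h1 r c hc)
    · intro F hF
      exact h2 F (hle (Ideal.mem_colon_span_singleton.mp hF))
  rw [this]
  exact IsKnutson.colon _ _ hI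

lemma knutson_of_dvd {d : MvPolynomial (Fin m × Fin n) K} (hf : f ≠ 0) (hd : d ∣ f) :
    IsKnutson f (Ideal.span {d}) := by
  obtain ⟨g, rfl⟩ := hd
  have hg : g ≠ 0 := right_ne_zero_of_mul hf
  have : Ideal.span {d} = (Ideal.span {d * g}).colon (Ideal.span {g}) := by
    ext x
    rw [Ideal.mem_colon_span_singleton, Ideal.mem_span_singleton, Ideal.mem_span_singleton,
      mul_dvd_mul_iff_right hg]
  rw [this]
  exact IsKnutson.colon _ _ IsKnutson.base

lemma laplace_mem {t lo hi : ℕ} (r : Fin (t+1) → Fin m) (c : Fin (t+1) → Fin n) (v : ℕ)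
    (h : ∀ l, (lo ≤ (c l).val ∧ (c l).val < hi) ∨ (c l).val = v) :
    mdet X r c ∈ Acol K m n t lo hi := by
  have key : ∀ l0, (∀ l, l ≠ l0 → lo ≤ (c l).val ∧ (c l).val < hi) →
      mdet X r c ∈ Acol K m n t lo hi := by
    intro l0 hl0
    unfold mdet
    rw [Matrix.det_succ_column _ l0]
    refine Ideal.sum_mem _ fun i _ => Ideal.mul_mem_left _ _ ?_
    exact mem_Acol (fun k => r (i.succAbove k)) (fun k => c (l0.succAbove k))
      fun k => hl0 _ (Fin.succAbove_ne _ _)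
  by_cases hc : Function.Injective c
  · by_cases hv : ∃ l0, (c l0).val = v
    · obtain ⟨l0, hl0⟩ := hv
      refine key l0 fun l hl => (h l).resolve_right fun h' => hl (hc (Fin.ext ?_))
      omega
    · push Not at hv
      exact key 0 fun l _ => (h l).resolve_right (hv l)
  · rw [mdet_eq_zero_of_col _ _ _ hc]
    exact Ideal.zero_mem _

lemma Acol_le_laplace {t lo hi lo' hi' : ℕ} (v : ℕ)
    (h : ∀ j, lo' ≤ j → j < hi' → (lo ≤ j ∧ j < hi) ∨ j = v) :
    Acol K m n (t+1) lo' hi' ≤ Acol K m n t lo hi := by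
  refine Ideal.span_le.mpr ?_
  rintro _ ⟨r, c, hc, rfl⟩
  exact laplace_mem r c v fun l => h _ (hc l).1 (hc l).2

lemma Acol_mono {t lo hi lo' hi' : ℕ} (h1 : lo ≤ lo') (h2 : hi' ≤ hi) :
    Acol K m n t lo' hi' ≤ Acol K m n t lo hi := by
  refine Ideal.span_le.mpr ?_
  rintro _ ⟨r, c, hc, rfl⟩
  exact mem_Acol r c fun l => ⟨h1.trans (hc l).1, (hc l).2.trans_le h2⟩

/-- interior step -/
lemma knutson_interior {p k : ℕ} (hm : p + 2 ≤ m) (hk : k + p + 3 ≤ n)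
    (h1 : IsKnutson f (Acol K m n (p+2) k (k+p+2)))
    (h2 : IsKnutson f (Acol K m n (p+2) (k+1) (k+p+3))) :
    IsKnutson f (Acol K m n (p+1) (k+1) (k+p+2)) := by
  let r' : Fin (p+2) → Fin m := Fin.castLE hm
  let c' : Fin (p+2) → Fin n := fun l => ⟨if l.val = 0 then k else k + 1 + l.val, by
    have := l.2; split_ifs <;> omega⟩
  have hr' : Function.Injective r' := Fin.castLE_injective _
  have hc' : Function.Injective c' := by
    intro i j hij
    have := congrArg Fin.val hij
    simp only [c'] at this
    ext
    split_ifs at this <;> omega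
  refine knutson_colon (mdet X r' c') (IsKnutson.add _ _ h1 h2) ?_ ?_ ?_
  · exact sup_le (Acol_le_laplace k (by omega)) (Acol_le_laplace (k+p+2) (by omega))
  · intro r c hc
    refine exchange X r c ⟨k, by omega⟩ r' c' 0 (by simp [c']) _ ?_ ?_
    · intro i
      refine Ideal.mem_sup_left (mem_Acol _ _ fun j => ?_)
      refine Fin.cases ?_ (fun j => ?_) j
      · simp
        omega
      · have := hc j
        simp only [Fin.cons_succ]
        omega
    · intro j
      refine Ideal.mem_sup_right (mem_Acol _ _ fun l => ?_)
      by_cases hl : l = 0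
      · subst hl
        have := hc j
        simp only [Function.update_self]
        omega
      · rw [Function.update_of_ne hl]
        have hl' : l.val ≠ 0 := fun h => hl (Fin.ext h)
        have := l.2
        simp only [c', if_neg hl']
        omega
  · intro F hF
    refine nzd (by omega) (by omega) r' c' hr' hc' ?_ F hF
    have hlt : ∀ l : {l // k + 1 ≤ (c' l).val ∧ (c' l).val < k + p + 2},
        1 ≤ l.1.val ∧ l.1.val - 1 < p := by
      rintro ⟨l, hl⟩
      simp only [c'] at hl ⊢
      split_ifs at hl <;> omega
    have := Fintype.card_le_of_injective
      (fun l : {l // k + 1 ≤ (c' l).val ∧ (c' l).val < k + p + 2} =>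
        (⟨l.1.val - 1, (hlt l).2⟩ : Fin p)) (by
        intro l l' h
        have h1 := hlt l
        have h2 := hlt l'
        simp only [Fin.mk.injEq] at h
        apply Subtype.ext
        apply Fin.ext
        omega)
    simpa using this

/-- edge step -/
lemma knutson_edge {p lo lo' : ℕ} (v : Fin n) (R0 : Fin (p+1) → Fin m)
    (hR0 : Function.Injective R0) (hlo : lo + (p + 1) ≤ n)
    (hlo' : (lo' = lo ∧ v.val = lo + (p + 1)) ∨ (lo' + 1 = lo ∧ v.val = lo'))
    (h1 : IsKnutson f (Acol K m n (p+2) lo' (lo' + (p + 2))))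
    (h2 : IsKnutson f (Ideal.span {mdet X R0 (fun j : Fin (p+1) => (⟨lo + j.val, by omega⟩ : Fin n))})) :
    IsKnutson f (Acol K m n (p+1) lo (lo + (p + 1))) := by
  set c0 : Fin (p+1) → Fin n := fun j => ⟨lo + j.val, by omega⟩ with hc0
  let c' := Function.update c0 0 v
  have hc' : Function.Injective c' := by
    intro i j hij
    have := congrArg Fin.val hij
    have hi := i.2
    have hj := j.2
    simp only [c', Function.update_apply, c0] at this
    by_cases h0 : i = 0 <;> by_cases h0' : j = 0
    · rw [h0, h0']
    · rw [if_pos h0, if_neg h0'] at this; simp only at this; omega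
    · rw [if_neg h0, if_pos h0'] at this; simp only at this; omega
    · rw [if_neg h0, if_neg h0'] at this; simp only at this; ext; omega
  have hin : ∀ j, lo ≤ (c0 j).val ∧ (c0 j).val < lo + (p+1) := by
    intro j
    have := j.2
    simp only [c0]
    omega
  refine knutson_colon (mdet X R0 c') (IsKnutson.add _ _ h1 h2) ?_ ?_ ?_
  · refine sup_le (Acol_le_laplace v.val (by omega)) ?_
    rw [Ideal.span_le, Set.singleton_subset_iff]
    exact mem_Acol _ _ hin
  · intro r c hc
    refine exchange X r c v R0 c' 0 (by simp [c']) _ ?_ ?_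
    · intro i
      refine Ideal.mem_sup_left (mem_Acol _ _ fun j => ?_)
      refine Fin.cases ?_ (fun j => ?_) j
      · simp only [Fin.cons_zero]
        omega
      · have := hc j
        simp only [Fin.cons_succ]
        omega
    · intro j
      refine Ideal.mem_sup_right ?_
      have hall : ∀ l, lo ≤ (Function.update c' 0 (c j) l).val ∧
          (Function.update c' 0 (c j) l).val < lo + (p+1) := by
        intro l
        by_cases hl : l = 0
        · subst hl
          simpa using hc j
        · simp only [c', Function.update_of_ne hl]
          exact hin l
      have : Function.update c' 0 (c j) = c0 ∘ fun l =>
          (⟨(Function.update c' 0 (c j) l).val - lo, by have := hall l; omega⟩ : Fin (p+1)) := by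
        funext l
        have := hall l
        ext
        simp only [Function.comp, c0]
        omega
      rw [this]
      exact mdet_comp_mem X R0 c0 id _ _ (Ideal.subset_span rfl)
  · intro F hF
    refine nzd (by omega) (by omega) R0 c' hR0 hc' ?_ F hF
    have : Fintype.card {l // lo ≤ (c' l).val ∧ (c' l).val < lo + (p + 1)} <
        Fintype.card (Fin (p+1)) := by
      refine Fintype.card_subtype_lt (x := 0) ?_
      simp only [c', Function.update_self]
      omega
    rw [Fintype.card_fin] at this
    omega

/-- enlarging step -/
lemma knutson_enlarge {p w : ℕ} (hp : p ≤ m) (hw : p + 1 ≤ w) (hwn : w + 1 ≤ n)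
    (h1 : IsKnutson f (Acol K m n (p+1) 0 w))
    (h2 : IsKnutson f (Acol K m n (p+1) (w - p) (w - p + (p + 1)))) :
    IsKnutson f (Acol K m n (p+1) 0 (w+1)) := by
  let r : Fin p → Fin m := Fin.castLE hp
  let c : Fin p → Fin n := fun l => ⟨w - p + l.val, by omega⟩
  have hr : Function.Injective r := Fin.castLE_injective _
  have hc : Function.Injective c := by
    intro i j hij
    have := congrArg Fin.val hij
    simp only [c] at this
    ext
    omega
  refine knutson_colon (mdet X r c) (IsKnutson.add _ _ h1 h2) ?_ ?_ ?_
  · exact sup_le (Acol_mono le_rfl (by omega)) (Acol_mono (by omega) (by omega))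
  · intro r' c' hc'
    by_cases hinj : Function.Injective c'
    swap
    · rw [mdet_eq_zero_of_col _ _ _ hinj, zero_mul]
      exact Ideal.zero_mem _
    by_cases hex : ∃ l, (c' l).val = w
    swap
    · push Not at hex
      refine Ideal.mul_mem_right _ _ (Ideal.mem_sup_left (mem_Acol _ _ fun j => ?_))
      have := hex j
      have := hc' j
      omega
    obtain ⟨l, hl⟩ := hex
    rw [mul_comm]
    refine exchange X r c (c' l) r' c' l rfl _ ?_ ?_
    · intro i
      refine Ideal.mem_sup_right (mem_Acol _ _ fun j => ?_)
      refine Fin.cases ?_ (fun j => ?_) j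
      · simp only [Fin.cons_zero]
        omega
      · simp only [Fin.cons_succ, c]
        omega
    · intro j
      refine Ideal.mem_sup_left (mem_Acol _ _ fun l' => ?_)
      by_cases hl' : l' = l
      · subst hl'
        simp only [Function.update_self, c]
        omega
      · rw [Function.update_of_ne hl']
        have := hc' l'
        have : (c' l').val ≠ w := fun h => hl' (hinj (Fin.ext (by omega)))
        omega
  · intro F hF
    refine nzd (by omega) (by omega) r c hr hc ?_ F hF
    exact (Fintype.card_subtype_le _).trans (by simp)

end main

section final
open MvPolynomial
variable {K : Type*} [Field K] {m n : ℕ}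

lemma knutsonF_ne_zero (hm : 0 < m) (hmn : m < n) : knutsonF K m n hm hmn ≠ 0 := by
  unfold knutsonF
  refine mul_ne_zero ?_ ?_
  · refine Finset.prod_ne_zero_iff.mpr fun k _ => mul_ne_zero ?_ ?_
    · refine mdet_X_ne_zero (K := K) (m := m) (n := n)
        (fun i : Fin (k.val+1) => ⟨m - 1 - k.val + i.val, by omega⟩) (fun j => ⟨j.val, by omega⟩) ?_ ?_
      · intro i j h; simp only [Fin.mk.injEq] at h; ext; omega
      · intro i j h; simp only [Fin.mk.injEq] at h; ext; omega
    · refine mdet_X_ne_zero (K := K) (m := m) (n := n)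
        (fun i : Fin (k.val+1) => ⟨i.val, by omega⟩) (fun j => ⟨n - 1 - k.val + j.val, by omega⟩) ?_ ?_
      · intro i j h; simp only [Fin.mk.injEq] at h; ext; omega
      · intro i j h; simp only [Fin.mk.injEq] at h; ext; omega
  · refine Finset.prod_ne_zero_iff.mpr fun k _ => ?_
    refine mdet_X_ne_zero (K := K) (m := m) (n := n)
        (fun i : Fin m => ⟨i.val, i.isLt⟩) (fun j => ⟨k.val + j.val, by omega⟩) ?_ ?_
    · intro i j h; simp only [Fin.mk.injEq] at h; ext; omega
    · intro i j h; simp only [Fin.mk.injEq] at h; ext; omega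

lemma knutson_max (hm : 0 < m) (hmn : m < n) (k : ℕ) (hk : k + m ≤ n) :
    IsKnutson (knutsonF K m n hm hmn) (Acol K m n m k (k + m)) := by
  let c0 : Fin m → Fin n := fun j => ⟨k + j.val, by omega⟩
  have : Acol K m n m k (k + m) = Ideal.span {mdet X (fun i => i) c0} := by
    apply le_antisymm
    · refine Ideal.span_le.mpr ?_
      rintro _ ⟨r, c, hc, rfl⟩
      have h : c = c0 ∘ fun l => (⟨(c l).val - k, by have := hc l; omega⟩ : Fin m) := by
        funext l
        have := hc l
        ext
        simp only [Function.comp, c0]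
        omega
      rw [h]
      exact mdet_comp_mem X (fun i => i) c0 r _ _ (Ideal.subset_span rfl)
    · rw [Ideal.span_le, Set.singleton_subset_iff]
      refine mem_Acol _ _ fun j => ?_
      simp only [c0]
      omega
  rw [this]
  refine knutson_of_dvd (knutsonF_ne_zero hm hmn) ?_
  unfold knutsonF
  refine Dvd.dvd.mul_left ?_ _
  refine dvd_trans ?_ (Finset.dvd_prod_of_mem _ (Finset.mem_univ (⟨k, by omega⟩ : Fin (n - m + 1))))
  unfold mdet
  exact dvd_rfl

lemma knutson_corner_left (hm : 0 < m) (hmn : m < n) (p : ℕ) (hp : p + 1 < m) :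
    IsKnutson (knutsonF K m n hm hmn) (Ideal.span {mdet X
      (fun i : Fin (p+1) => (⟨m - 1 - p + i.val, by omega⟩ : Fin m))
      (fun j : Fin (p+1) => (⟨0 + j.val, by omega⟩ : Fin n))}) := by
  refine knutson_of_dvd (knutsonF_ne_zero hm hmn) ?_
  unfold knutsonF
  refine Dvd.dvd.mul_right ?_ _
  refine dvd_trans ?_ (Finset.dvd_prod_of_mem _ (Finset.mem_univ (⟨p, by omega⟩ : Fin (m - 1))))
  refine Dvd.dvd.mul_right ?_ _
  unfold mdet
  simp only [Nat.zero_add]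
  exact dvd_rfl

lemma knutson_corner_right (hm : 0 < m) (hmn : m < n) (p lo : ℕ) (hp : p + 1 < m)
    (hlo : lo + (p + 1) = n) :
    IsKnutson (knutsonF K m n hm hmn) (Ideal.span {mdet X
      (fun i : Fin (p+1) => (⟨i.val, by omega⟩ : Fin m))
      (fun j : Fin (p+1) => (⟨lo + j.val, by omega⟩ : Fin n))}) := by
  obtain rfl : lo = n - 1 - p := by omega
  refine knutson_of_dvd (knutsonF_ne_zero hm hmn) ?_
  unfold knutsonF
  refine Dvd.dvd.mul_right ?_ _
  refine dvd_trans ?_ (Finset.dvd_prod_of_mem _ (Finset.mem_univ (⟨p, by omega⟩ : Fin (m - 1))))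
  exact Dvd.dvd.mul_left dvd_rfl _

lemma knutson_blocks (hm : 0 < m) (hmn : m < n) (q : ℕ) : ∀ t, t + q = m → 1 ≤ t → ∀ k,
    k + t ≤ n → IsKnutson (knutsonF K m n hm hmn) (Acol K m n t k (k + t)) := by
  induction q with
  | zero =>
    intro t ht _ k hk
    obtain rfl : t = m := by omega
    exact knutson_max hm hmn k hk
  | succ q ih =>
    intro t ht h1 k hk
    obtain ⟨p, rfl⟩ : ∃ p, t = p + 1 := ⟨t - 1, by omega⟩
    have ih' := ih (p + 2) (by omega) (by omega)
    rcases Nat.eq_zero_or_pos k with rfl | hk0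
    · refine knutson_edge (lo' := 0) ⟨p + 1, by omega⟩ _ ?_ hk (Or.inl ⟨rfl, by simp⟩)
        (ih' 0 (by omega)) (knutson_corner_left hm hmn p (by omega))
      intro i j h; simp only [Fin.mk.injEq] at h; ext; omega
    · obtain ⟨k, rfl⟩ : ∃ k', k = k' + 1 := ⟨k - 1, by omega⟩
      by_cases hkn : k + 1 + (p + 1) = n
      · refine knutson_edge (lo' := k) ⟨k, by omega⟩ _ ?_ hk (Or.inr ⟨rfl, rfl⟩)
          (ih' k (by omega)) (knutson_corner_right hm hmn p (k+1) (by omega) hkn)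
        intro i j h; simp only [Fin.mk.injEq] at h; ext; omega
      · have e1 : k + 1 + (p + 1) = k + p + 2 := by omega
        rw [e1]
        have a1 := ih' k (by omega)
        have a2 := ih' (k + 1) (by omega)
        have e2 : k + (p + 2) = k + p + 2 := by omega
        have e3 : k + 1 + (p + 2) = k + p + 3 := by omega
        rw [e2] at a1
        rw [e3] at a2
        exact knutson_interior (by omega) (by omega) a1 a2

lemma genMinors_eq (t : ℕ) : genMinors K m n t 1 m 1 n = Acol K m n t 0 n := by
  apply le_antisymm
  · refine Ideal.span_le.mpr ?_
    rintro _ ⟨r, c, _, _, _, _, rfl⟩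
    exact mem_Acol r c fun j => ⟨Nat.zero_le _, (c j).2⟩
  · refine Ideal.span_le.mpr ?_
    rintro _ ⟨r, c, _, rfl⟩
    by_cases hr : Function.Injective r
    swap
    · rw [mdet_eq_zero_of_row _ _ _ hr]; exact Ideal.zero_mem _
    by_cases hc : Function.Injective c
    swap
    · rw [mdet_eq_zero_of_col _ _ _ hc]; exact Ideal.zero_mem _
    have h1 : StrictMono (r ∘ Tuple.sort r) :=
      (Tuple.monotone_sort r).strictMono_of_injective (hr.comp (Tuple.sort r).injective)
    have h2 : StrictMono (c ∘ Tuple.sort c) :=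
      (Tuple.monotone_sort c).strictMono_of_injective (hc.comp (Tuple.sort c).injective)
    have h3 : mdet X (r ∘ Tuple.sort r) (c ∘ Tuple.sort c) ∈ genMinors K m n t 1 m 1 n := by
      refine Ideal.subset_span ⟨_, _, h1, h2, fun i => ?_, fun j => ?_, rfl⟩
      · have := ((r ∘ Tuple.sort r) i).2
        omega
      · have := ((c ∘ Tuple.sort c) j).2
        omega
    have h4 := mdet_comp_mem X _ _ (Tuple.sort r).symm (Tuple.sort c).symm _ h3
    simpa [Function.comp_assoc] using h4

end final

/-- Determinantal ideals of the generic matrix are Knutson ideals: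
for every `1 ≤ t ≤ m`, `I_t(X) ∈ C_f`. -/
theorem determinantal_generic_isKnutson (K : Type*) [Field K] (m n : ℕ)
    (hm : 0 < m) (hmn : m < n) (t : ℕ) (ht1 : 1 ≤ t) (htm : t ≤ m) :
    IsKnutson (knutsonF K m n hm hmn) (genMinors K m n t 1 m 1 n) := by
  rw [genMinors_eq]
  obtain ⟨p, rfl⟩ : ∃ p, t = p + 1 := ⟨t - 1, by omega⟩
  have hb := knutson_blocks (K := K) hm hmn (m - (p + 1)) (p + 1) (by omega) ht1
  have : ∀ w, p + 1 ≤ w → w ≤ n →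
      IsKnutson (knutsonF K m n hm hmn) (Acol K m n (p+1) 0 w) := by
    intro w hw
    induction w, hw using Nat.le_induction with
    | base =>
      intro h
      have := hb 0 (by omega)
      rwa [Nat.zero_add] at this
    | succ w hw ih =>
      intro h
      exact knutson_enlarge (by omega) hw h (ih (by omega)) (hb (w - p) (by omega))
  exact this n (by omega) le_rfl
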